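/- arXiv:1906.06777 — 3 statements merged into one kernel-verified Lean document; each statement's English description precedes it below -/
import Mathlib

section
/- Let K be an infinite field and let m, p be positive integers. Let S, T be m×p binary matrices and let R be a p×p reflexive binary matrix. Then the following are equivalent: (1) T ≤ S and T·R^{p-1} ≤ S (Boolean product and power); (2) for every m×p matrix Y over K with Y ∈ Sparse(T) and every invertible p×p matrix X over K with X ∈ Sparse(R), the product Y·X⁻¹ lies in Sparse(S). (Theorem 1: full characterization of Sparsity Invariance.) -/
/-- Boolean (logical) matrix product. -/
def bmul {m p q : ℕ} (A : Matrix (Fin m) (Fin p) Bool) (B : Matrix (Fin p) (Fin q) Bool) :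
    Matrix (Fin m) (Fin q) Bool :=
  fun i k => decide (∃ j, A i j = true ∧ B j k = true)

/-- Identity binary matrix. -/
def bId (p : ℕ) : Matrix (Fin p) (Fin p) Bool := fun i j => decide (i = j)

/-- Boolean (entrywise OR) sum of binary matrices. -/
def badd {m p : ℕ} (A B : Matrix (Fin m) (Fin p) Bool) : Matrix (Fin m) (Fin p) Bool :=
  fun i j => A i j || B i j

/-- k-fold Boolean power (bpow R 0 = identity). -/
def bpow {p : ℕ} (R : Matrix (Fin p) (Fin p) Bool) : ℕ → Matrix (Fin p) (Fin p) Bool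
  | 0 => bId p
  | k + 1 => bmul (bpow R k) R

/-- Entrywise order on binary matrices. -/
def bLE {m p : ℕ} (A B : Matrix (Fin m) (Fin p) Bool) : Prop :=
  ∀ i j, A i j = true → B i j = true

/-- A square binary matrix is reflexive if all diagonal entries are 1. -/
def BRefl {p : ℕ} (R : Matrix (Fin p) (Fin p) Bool) : Prop := ∀ i, R i i = true

/-- Y ∈ Sparse(T): Y vanishes wherever the pattern T is zero. -/
def Sparse {K : Type*} [Field K] {m p : ℕ} (T : Matrix (Fin m) (Fin p) Bool)
    (Y : Matrix (Fin m) (Fin p) K) : Prop :=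
  ∀ i j, T i j = false → Y i j = 0

open Matrix in
/-- The entry of a product of sparse matrices vanishes off the Boolean product of the patterns. -/
theorem Sparse.mul {K : Type*} [Field K] {m p q : ℕ} {A : Matrix (Fin m) (Fin p) Bool}
    {B : Matrix (Fin p) (Fin q) Bool} {Y : Matrix (Fin m) (Fin p) K}
    {Z : Matrix (Fin p) (Fin q) K} (hY : Sparse A Y) (hZ : Sparse B Z) :
    Sparse (bmul A B) (Y * Z) := by
  intro i k h
  rw [mul_apply]
  refine Finset.sum_eq_zero fun j _ => ?_
  simp only [bmul, decide_eq_false_iff_not, not_exists, not_and] at h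
  cases hA : A i j
  · rw [hY i j hA, zero_mul]
  · rw [hZ j k (by simpa using h j hA), mul_zero]

theorem Sparse.mono {K : Type*} [Field K] {m p : ℕ} {A B : Matrix (Fin m) (Fin p) Bool}
    {Y : Matrix (Fin m) (Fin p) K} (hY : Sparse A Y) (h : bLE A B) : Sparse B Y := by
  intro i j hB
  refine hY i j ?_
  by_contra hA
  simp [h i j (by simpa using hA)] at hB

theorem sparse_one {K : Type*} [Field K] {p : ℕ} {R : Matrix (Fin p) (Fin p) Bool}
    (hR : BRefl R) : Sparse R (1 : Matrix (Fin p) (Fin p) K) := by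
  intro i j h
  refine Matrix.one_apply_ne ?_
  rintro rfl
  simp [hR i] at h

theorem sparse_pow {K : Type*} [Field K] {p : ℕ} {R : Matrix (Fin p) (Fin p) Bool}
    {X : Matrix (Fin p) (Fin p) K} (hX : Sparse R X) (n : ℕ) : Sparse (bpow R n) (X ^ n) := by
  induction n with
  | zero => exact sparse_one fun i => by simp [bpow, bId]
  | succ n ih => rw [pow_succ]; exact ih.mul hX

theorem bpow_mono {p : ℕ} {R : Matrix (Fin p) (Fin p) Bool} (hR : BRefl R) {k n : ℕ}
    (h : k ≤ n) : bLE (bpow R k) (bpow R n) := by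
  induction n, h using Nat.le_induction with
  | base => exact fun _ _ h => h
  | succ n _ ih =>
    intro i j hij
    simp only [bpow, bmul, decide_eq_true_eq]
    exact ⟨j, ih i j hij, hR j⟩

open Polynomial in
/-- By Cayley–Hamilton, the inverse of a `p × p` matrix is a polynomial in it of degree
at most `p - 1`. -/
theorem Matrix.exists_inv_eq_aeval {K : Type*} [Field K] {p : ℕ}
    (X : Matrix (Fin p) (Fin p) K) (hX : IsUnit X.det) :
    ∃ f : K[X], f.natDegree ≤ p - 1 ∧ X⁻¹ = aeval X f := by
  have h := X.aeval_self_charpoly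
  have h0 : X.charpoly.coeff 0 ≠ 0 := by
    intro h0
    apply hX.ne_zero
    rw [X.det_eq_sign_charpoly_coeff, h0, mul_zero]
  rw [← X.charpoly.divX_mul_X_add] at h
  simp only [map_add, map_mul, aeval_X, aeval_C] at h
  refine ⟨C (-(X.charpoly.coeff 0)⁻¹) * X.charpoly.divX, ?_, ?_⟩
  · refine natDegree_C_mul_le _ _ |>.trans ?_
    rw [natDegree_divX_eq_natDegree_tsub_one, X.charpoly_natDegree_eq_dim, Fintype.card_fin]
  · refine Matrix.inv_eq_left_inv ?_
    rw [map_mul, aeval_C, mul_assoc, eq_neg_of_add_eq_zero_left h, ← map_neg, ← map_mul]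
    simp [h0]

theorem sparse_inv {K : Type*} [Field K] {p : ℕ} {R : Matrix (Fin p) (Fin p) Bool}
    (hR : BRefl R) {X : Matrix (Fin p) (Fin p) K} (hdet : IsUnit X.det) (hX : Sparse R X) :
    Sparse (bpow R (p - 1)) X⁻¹ := by
  obtain ⟨f, hf, h⟩ := X.exists_inv_eq_aeval hdet
  intro i j hij
  rw [h, Polynomial.aeval_eq_sum_range, Matrix.sum_apply]
  refine Finset.sum_eq_zero fun k hk => ?_
  have hk' : k ≤ p - 1 := by have := Finset.mem_range.1 hk; omega
  rw [Matrix.smul_apply, (sparse_pow hX k).mono (bpow_mono hR hk') i j hij, smul_zero]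

namespace Matrix

open Polynomial

variable {K : Type*} [Field K] {n : Type*} [Fintype n] [DecidableEq n]

/-- The line `A + t D` as a matrix over the polynomial ring in `t`. -/
noncomputable def linePoly (A D : Matrix n n K) : Matrix n n K[X] :=
  fun i j => C (A i j) + X * C (D i j)

theorem mapMatrix_eval_linePoly (A D : Matrix n n K) (t : K) :
    (evalRingHom t).mapMatrix (linePoly A D) = A + t • D := by
  ext i j
  simp [linePoly, mul_comm t, -X_mul_C]

theorem eval_det_linePoly (A D : Matrix n n K) (t : K) :
    (linePoly A D).det.eval t = (A + t • D).det := by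
  rw [← mapMatrix_eval_linePoly, ← RingHom.map_det, coe_evalRingHom]

theorem eval_adjugate_linePoly (A D : Matrix n n K) (t : K) (i j : n) :
    ((linePoly A D).adjugate i j).eval t = (A + t • D).adjugate i j := by
  rw [← mapMatrix_eval_linePoly, ← RingHom.map_adjugate]
  rfl

theorem inv_apply_ne_zero_iff {A : Matrix n n K} (hA : A.det ≠ 0) (i j : n) :
    A⁻¹ i j ≠ 0 ↔ A.adjugate i j ≠ 0 := by
  simp [inv_def, hA]

theorem exists_eval_ne_zero [Infinite K] {f : K[X]} (hf : f ≠ 0) : ∃ t, f.eval t ≠ 0 := by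
  by_contra! h
  exact hf (Polynomial.funext fun t => by simpa using h t)

theorem linePoly_det_ne_zero {A : Matrix n n K} (D : Matrix n n K) (hA : A.det ≠ 0) :
    (linePoly A D).det ≠ 0 := by
  intro h
  have := eval_det_linePoly A D 0
  simp [h] at this
  exact hA this.symm

/-- On the line through `A` and `1` there is an invertible matrix whose inverse keeps a nonzero
entry of `A⁻¹` and has a prescribed nonzero diagonal entry. -/
theorem exists_line_inv_ne_zero [Infinite K] {A : Matrix n n K} (hA : A.det ≠ 0) {j l : n}
    (hjl : A⁻¹ j l ≠ 0) (k : n) :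
    ∃ t : K, (A + t • (1 - A)).det ≠ 0 ∧ (A + t • (1 - A))⁻¹ j l ≠ 0 ∧
      (A + t • (1 - A))⁻¹ k k ≠ 0 := by
  have h1 := linePoly_det_ne_zero (1 - A) hA
  have h2 : (linePoly A (1 - A)).adjugate j l ≠ 0 := by
    intro h
    have := eval_adjugate_linePoly A (1 - A) 0 j l
    simp only [h, eval_zero, zero_smul, add_zero] at this
    exact (inv_apply_ne_zero_iff hA j l).1 hjl this.symm
  have h3 : (linePoly A (1 - A)).adjugate k k ≠ 0 := by
    intro h
    have := eval_adjugate_linePoly A (1 - A) 1 k k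
    simp [h] at this
  obtain ⟨t, ht⟩ := exists_eval_ne_zero (mul_ne_zero h1 (mul_ne_zero h2 h3))
  simp only [eval_mul, eval_det_linePoly, eval_adjugate_linePoly, mul_ne_zero_iff] at ht
  exact ⟨t, ht.1, (inv_apply_ne_zero_iff ht.1 _ _).2 ht.2.1,
    (inv_apply_ne_zero_iff ht.1 _ _).2 ht.2.2⟩

theorem exists_smul_det_ne_zero [Infinite K] {A : Matrix n n K} (D : Matrix n n K)
    (hA : A.det ≠ 0) : ∃ t : K, t ≠ 0 ∧ (A + t • D).det ≠ 0 := by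
  obtain ⟨t, ht⟩ := exists_eval_ne_zero (mul_ne_zero X_ne_zero (linePoly_det_ne_zero D hA))
  simp only [eval_mul, eval_X, eval_det_linePoly, mul_ne_zero_iff] at ht
  exact ⟨t, ht⟩

/-- Perturbing the `(l, k)` entry of `A` makes the `(j, k)` entry of the inverse nonzero. -/
theorem inv_add_single_apply_ne_zero {A : Matrix n n K} (hA : A.det ≠ 0) {j l k : n}
    (hjl : A⁻¹ j l ≠ 0) (hkk : A⁻¹ k k ≠ 0) (hjk : A⁻¹ j k = 0) {t : K} (ht : t ≠ 0)
    (hdet : (A + t • single l k (1 : K)).det ≠ 0) :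
    (A + t • single l k (1 : K))⁻¹ j k ≠ 0 := by
  set B := A + t • single l k (1 : K) with hB
  have key : B⁻¹ = A⁻¹ - t • (B⁻¹ * single l k 1 * A⁻¹) := by
    have h1 : B⁻¹ * B = 1 := nonsing_inv_mul _ hdet.isUnit
    have h2 : A * A⁻¹ = 1 := mul_nonsing_inv _ hA.isUnit
    calc B⁻¹ = B⁻¹ * (A * A⁻¹) := by rw [h2, mul_one]
      _ = B⁻¹ * (B - t • single l k 1) * A⁻¹ := by rw [hB, add_sub_cancel_right, mul_assoc]
      _ = A⁻¹ - t • (B⁻¹ * single l k 1 * A⁻¹) := by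
        rw [mul_sub, h1, sub_mul, one_mul, mul_smul_comm, smul_mul_assoc]
  have entry (x : n) : B⁻¹ j x = A⁻¹ j x - t * (B⁻¹ j l * A⁻¹ k x) := by
    conv_lhs => rw [key]
    rw [sub_apply, smul_apply, smul_eq_mul, mul_assoc, mul_apply, Finset.sum_eq_single l]
    · simp
    · intro b _ hb
      simp [hb]
    · simp
  intro h
  have hk := entry k
  rw [h, hjk, zero_sub, eq_comm, neg_eq_zero] at hk
  have hl : B⁻¹ j l = 0 := by simpa [ht, hkk] using hk
  have := entry l
  rw [hl, zero_mul, mul_zero, sub_zero] at this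
  exact hjl this.symm

end Matrix

theorem exists_sparse_inv_apply_ne_zero {K : Type*} [Field K] [Infinite K] {p : ℕ}
    {R : Matrix (Fin p) (Fin p) Bool} (hR : BRefl R) (n : ℕ) (j k : Fin p)
    (h : bpow R n j k = true) :
    ∃ X : Matrix (Fin p) (Fin p) K, X.det ≠ 0 ∧ Sparse R X ∧ X⁻¹ j k ≠ 0 := by
  induction n generalizing k with
  | zero =>
    obtain rfl : j = k := by simpa [bpow, bId] using h
    exact ⟨1, by simp, sparse_one hR, by simp⟩
  | succ n ih =>
    simp only [bpow, bmul, decide_eq_true_eq] at h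
    obtain ⟨l, hjl, hlk⟩ := h
    obtain ⟨X, hX, hRX, hXjl⟩ := ih l hjl
    obtain ⟨s, hA, hAjl, hAkk⟩ := Matrix.exists_line_inv_ne_zero hX hXjl k
    have hRA : Sparse R (X + s • (1 - X)) := fun a b hab => by
      simp [hRX a b hab, sparse_one (K := K) hR a b hab]
    generalize X + s • (1 - X) = A at hA hAjl hAkk hRA
    by_cases hjk : A⁻¹ j k = 0
    · obtain ⟨t, ht, hdet⟩ := Matrix.exists_smul_det_ne_zero (Matrix.single l k 1) hA
      refine ⟨_, hdet, fun a b hab => ?_,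
        Matrix.inv_add_single_apply_ne_zero hA hAjl hAkk hjk ht hdet⟩
      have : ¬ (l = a ∧ k = b) := by
        rintro ⟨rfl, rfl⟩
        simp [hlk] at hab
      simp [hRA a b hab, this]
    · exact ⟨A, hA, hRA, hjk⟩

theorem sparse_single {K : Type*} [Field K] {m p : ℕ} {T : Matrix (Fin m) (Fin p) Bool}
    {i : Fin m} {j : Fin p} (h : T i j = true) : Sparse T (Matrix.single i j (1 : K)) := by
  intro a b hab
  refine Matrix.single_apply_of_ne _ _ _ _ _ ?_
  rintro ⟨rfl, rfl⟩
  simp [h] at hab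

/-- Theorem 1, full characterization of Sparsity Invariance. -/
theorem sparsity_invariance_characterization {K : Type*} [Field K] [Infinite K] {m p : ℕ}
    (hm : 0 < m) (hp : 0 < p)
    (S T : Matrix (Fin m) (Fin p) Bool) (R : Matrix (Fin p) (Fin p) Bool)
    (hR : BRefl R) :
    (bLE T S ∧ bLE (bmul T (bpow R (p - 1))) S) ↔
      (∀ (Y : Matrix (Fin m) (Fin p) K), Sparse T Y →
        ∀ (X : Matrix (Fin p) (Fin p) K), IsUnit X.det → Sparse R X →
          Sparse S (Y * X⁻¹)) := by
  constructor
  · rintro ⟨-, hTS⟩ Y hY X hdet hX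
    exact (hY.mul (sparse_inv hR hdet hX)).mono hTS
  · intro h
    have entry {i : Fin m} {j k : Fin p} (n : ℕ) (hT : T i j = true)
        (hjk : bpow R n j k = true) : S i k = true := by
      obtain ⟨X, hX, hRX, hXjk⟩ := exists_sparse_inv_apply_ne_zero (K := K) hR n j k hjk
      by_contra hS
      have := h _ (sparse_single hT) X hX.isUnit hRX i k (by simpa using hS)
      simp [hXjk] at this
    refine ⟨fun i j hT => entry 0 hT (by simp [bpow, bId]), fun i k hik => ?_⟩
    simp only [bmul, decide_eq_true_eq] at hik
    obtain ⟨j, hT, hjk⟩ := hik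
    exact entry _ hT hjk
end

section
/- Let T be an m×p binary matrix, let 𝓡_T be the set of p×p reflexive binary matrices R with T·R^{p-1} ≤ T (Boolean product and power), and define R*_T by (R*_T)_{jk} = 0 iff there exists an index i with T_{ij} = 1 and T_{ik} = 0. If R' ∈ 𝓡_T satisfies R^{p-1} ≤ R' for every R ∈ 𝓡_T, then R' = R*_T. In particular, R*_T is the unique element of 𝓡_T that dominates R^{p-1} for every R ∈ 𝓡_T. (Uniqueness claim of Theorem 2.) -/
/-- Output of Algorithm 1: (R*_T)_{jk} = 0 iff ∃ i, T_{ij} = 1 and T_{ik} = 0. -/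
def Rstar {m p : ℕ} (T : Matrix (Fin m) (Fin p) Bool) : Matrix (Fin p) (Fin p) Bool :=
  fun j k => !decide (∃ i, T i j = true ∧ T i k = false)

theorem bpow_self_of_refl {p : ℕ} {R : Matrix (Fin p) (Fin p) Bool} (h : BRefl R) (n : ℕ)
    (j : Fin p) : bpow R n j j = true := by
  induction n with
  | zero => simp [bpow, bId]
  | succ n ih => exact decide_eq_true ⟨j, ih, h j⟩

theorem bLE_bpow_pred_of_refl {p : ℕ} {R : Matrix (Fin p) (Fin p) Bool} (h : BRefl R) :
    bLE R (bpow R (p - 1)) := by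
  intro j k hjk
  match p with
  | 0 => exact j.elim0
  | 1 => rw [Subsingleton.elim k j]; exact bpow_self_of_refl h _ j
  | p + 2 => exact decide_eq_true ⟨j, bpow_self_of_refl h p j, hjk⟩

theorem Rstar_eq_true_iff {m p : ℕ} (T : Matrix (Fin m) (Fin p) Bool) (j k : Fin p) :
    Rstar T j k = true ↔ ∀ i, T i j = true → T i k = true := by
  simp [Rstar]

theorem bRefl_Rstar {m p : ℕ} (T : Matrix (Fin m) (Fin p) Bool) : BRefl (Rstar T) :=
  fun j => (Rstar_eq_true_iff T j j).2 fun _ h => h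

theorem bpow_Rstar_le {m p : ℕ} (T : Matrix (Fin m) (Fin p) Bool) (n : ℕ) :
    bLE (bpow (Rstar T) n) (Rstar T) := by
  induction n with
  | zero =>
    intro j k h
    obtain rfl : j = k := of_decide_eq_true h
    exact bRefl_Rstar T j
  | succ n ih =>
    intro j k h
    obtain ⟨l, hjl, hlk⟩ := of_decide_eq_true h
    have hjl := (Rstar_eq_true_iff T j l).1 (ih j l hjl)
    have hlk := (Rstar_eq_true_iff T l k).1 hlk
    exact (Rstar_eq_true_iff T j k).2 fun i hi => hlk i (hjl i hi)

theorem bmul_bpow_Rstar_le {m p : ℕ} (T : Matrix (Fin m) (Fin p) Bool) (n : ℕ) :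
    bLE (bmul T (bpow (Rstar T) n)) T := by
  intro i k h
  obtain ⟨j, hij, hjk⟩ := of_decide_eq_true h
  exact (Rstar_eq_true_iff T j k).1 (bpow_Rstar_le T n j k hjk) i hij

/-- uniqueness claim of Theorem 2. -/
theorem Rstar_unique {m p : ℕ} (T : Matrix (Fin m) (Fin p) Bool)
    (R' : Matrix (Fin p) (Fin p) Bool)
    (hR'refl : BRefl R') (hR'mem : bLE (bmul T (bpow R' (p - 1))) T)
    (hdom : ∀ R : Matrix (Fin p) (Fin p) Bool, BRefl R → bLE (bmul T (bpow R (p - 1))) T →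
      bLE (bpow R (p - 1)) R') :
    R' = Rstar T := by
  ext j k
  rw [Bool.eq_iff_iff]
  constructor
  · intro h
    exact (Rstar_eq_true_iff T j k).2 fun i hi =>
      hR'mem i k (decide_eq_true ⟨j, hi, bLE_bpow_pred_of_refl hR'refl j k h⟩)
  · intro h
    exact hdom (Rstar T) (bRefl_Rstar T) (bmul_bpow_Rstar_le T _) j k
      (bLE_bpow_pred_of_refl (bRefl_Rstar T) j k h)
end

section
/- Let S be an m×p binary matrix and Δ a p×m binary matrix such that S·Δ·S ≤ S (Boolean products). Then S·(I_p + Δ·S)^{p-1} ≤ S, where the sum is Boolean (entrywise OR) and the power is the (p-1)-fold Boolean power. (Intermediate step in the proof of Theorem 3.) -/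
theorem bmul_apply_eq_true {m p q : ℕ} (A : Matrix (Fin m) (Fin p) Bool)
    (B : Matrix (Fin p) (Fin q) Bool) (i : Fin m) (k : Fin q) :
    bmul A B i k = true ↔ ∃ j, A i j = true ∧ B j k = true := by
  simp [bmul]

/-- Right multiplication by `I + Δ S` stays below `S`. -/
theorem bLE_bmul_badd_bId_bmul {m p : ℕ} {S : Matrix (Fin m) (Fin p) Bool}
    {Δ : Matrix (Fin p) (Fin m) Bool} (h : bLE (bmul (bmul S Δ) S) S) :
    bLE (bmul S (badd (bId p) (bmul Δ S))) S := by
  intro i k hik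
  obtain ⟨j, hij, hjk⟩ := (bmul_apply_eq_true ..).1 hik
  simp only [badd, bId, Bool.or_eq_true, decide_eq_true_eq, bmul_apply_eq_true] at hjk
  rcases hjk with rfl | ⟨l, hjl, hlk⟩
  · exact hij
  · exact h i k ((bmul_apply_eq_true ..).2 ⟨l, (bmul_apply_eq_true ..).2 ⟨j, hij, hjl⟩, hlk⟩)

theorem bLE_bmul_bpow {m p : ℕ} {S : Matrix (Fin m) (Fin p) Bool}
    {R : Matrix (Fin p) (Fin p) Bool} (h : bLE (bmul S R) S) (n : ℕ) :
    bLE (bmul S (bpow R n)) S := by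
  induction n with
  | zero =>
    intro i k hik
    obtain ⟨j, hij, hjk⟩ := (bmul_apply_eq_true ..).1 hik
    obtain rfl : j = k := by simpa [bpow, bId] using hjk
    exact hij
  | succ n ih =>
    intro i k hik
    obtain ⟨j, hij, hjk⟩ := (bmul_apply_eq_true ..).1 hik
    obtain ⟨l, hjl, hlk⟩ := (bmul_apply_eq_true ..).1 hjk
    exact h i k ((bmul_apply_eq_true ..).2
      ⟨l, ih i l ((bmul_apply_eq_true ..).2 ⟨j, hij, hjl⟩), hlk⟩)

/-- intermediate step in the proof of Theorem 3. -/
theorem QI_implies_power_bound {m p : ℕ}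
    (S : Matrix (Fin m) (Fin p) Bool) (Δ : Matrix (Fin p) (Fin m) Bool)
    (hQI : bLE (bmul (bmul S Δ) S) S) :
    bLE (bmul S (bpow (badd (bId p) (bmul Δ S)) (p - 1))) S := by
  exact bLE_bmul_bpow (bLE_bmul_badd_bId_bmul hQI) (p - 1)
end
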